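/- For every x = (x₁,x₂) ∈ ℤ² and every e ∈ (0,4) with e ≠ 2, the boundary values of the lattice Green's function exist: the limits g₊(e; x) = lim_{ε→0⁺} g(e + iε; x) and g₋(e; x) = lim_{ε→0⁺} g(e - iε; x) exist in ℂ. -/

import Mathlib

open MeasureTheory Real Complex

/-- The lattice Green's function of the 2D discrete Laplacian:
`g(z; x₁, x₂) = (2π)⁻² ∫_{[-π,π]²} e^{-i(k₁x₁+k₂x₂)} / (ω(k) - z) dk`. -/
noncomputable def latticeGreen (z : ℂ) (x₁ x₂ : ℤ) : ℂ :=
  ((2 * Real.pi) ^ 2)⁻¹ •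
    ∫ k in Set.Icc ((-Real.pi, -Real.pi) : ℝ × ℝ) ((Real.pi, Real.pi) : ℝ × ℝ),
      Complex.exp (-Complex.I * ((k.1 : ℂ) * (x₁ : ℂ) + (k.2 : ℂ) * (x₂ : ℂ))) /
        (((2 - Real.cos k.1 - Real.cos k.2 : ℝ) : ℂ) - z)

/-- The square root with nonnegative real and imaginary part, continuous on all of `ℂ`; it squares
to its argument on the closed upper half plane. -/
noncomputable def quadrantSqrt (w : ℂ) : ℂ :=
  ⟨√((‖w‖ + w.re) / 2), √((‖w‖ - w.re) / 2)⟩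

lemma continuous_quadrantSqrt : Continuous quadrantSqrt := by
  have h : quadrantSqrt = fun w : ℂ =>
      ((√((‖w‖ + w.re) / 2) : ℝ) : ℂ) + ((√((‖w‖ - w.re) / 2) : ℝ) : ℂ) * I := by
    funext w
    exact Complex.mk_eq_add_mul_I _ _
  rw [h]
  fun_prop

lemma quadrantSqrt_sq {w : ℂ} (hw : 0 ≤ w.im) : quadrantSqrt w ^ 2 = w := by
  have h := abs_le.mp (Complex.abs_re_le_norm w)
  have h1 : 0 ≤ (‖w‖ + w.re) / 2 := by linarith
  have h2 : 0 ≤ (‖w‖ - w.re) / 2 := by linarith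
  have h3 : √((‖w‖ + w.re) / 2) * √((‖w‖ - w.re) / 2) = w.im / 2 := by
    rw [← Real.sqrt_mul h1, Real.sqrt_eq_iff_mul_self_eq (by positivity) (by positivity)]
    have := Complex.sq_norm w
    rw [Complex.normSq_apply] at this
    nlinarith
  apply Complex.ext
  · simp only [quadrantSqrt, sq, Complex.mul_re, Real.mul_self_sqrt h1, Real.mul_self_sqrt h2]
    ring
  · simp only [quadrantSqrt, sq, Complex.mul_im]
    linarith

lemma quadrantSqrt_re_pos {w : ℂ} (hw : 0 < w.im) : 0 < (quadrantSqrt w).re := by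
  have h := abs_lt.mp (Complex.abs_re_lt_norm.mpr hw.ne')
  exact Real.sqrt_pos.mpr (by linarith)

lemma quadrantSqrt_im_pos {w : ℂ} (hw : 0 < w.im) : 0 < (quadrantSqrt w).im := by
  have h := abs_lt.mp (Complex.abs_re_lt_norm.mpr hw.ne')
  exact Real.sqrt_pos.mpr (by linarith)

lemma norm_quadrantSqrt {w : ℂ} (hw : 0 ≤ w.im) : ‖quadrantSqrt w‖ = √‖w‖ := by
  rw [eq_comm, Real.sqrt_eq_iff_mul_self_eq (norm_nonneg _) (norm_nonneg _), ← norm_mul, ← sq,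
    quadrantSqrt_sq hw]

lemma norm_sub_lt_norm_add_of_quadrant {p q : ℂ} (hp : 0 < p.re) (hp' : 0 < p.im)
    (hq : 0 < q.re) (hq' : 0 < q.im) : ‖q - p‖ < ‖q + p‖ := by
  rw [← sq_lt_sq₀ (norm_nonneg _) (norm_nonneg _), Complex.sq_norm, Complex.sq_norm,
    Complex.normSq_apply, Complex.normSq_apply]
  simp only [Complex.sub_re, Complex.sub_im, Complex.add_re, Complex.add_im]
  nlinarith [mul_pos hp hq, mul_pos hp' hq']

lemma integral_exp_int_mul_I (j : ℤ) :
    ∫ k in (-π)..π, cexp (I * k * j) = if j = 0 then 2 * (π : ℂ) else 0 := by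
  split_ifs with hj
  · subst hj
    simp
    ring
  · have hj' : (I * j : ℂ) ≠ 0 := mul_ne_zero I_ne_zero (by exact_mod_cast hj)
    have : ∀ k : ℝ, cexp (I * k * j) = cexp ((I * j) * k) := fun k => by ring_nf
    simp_rw [this]
    rw [integral_exp_mul_complex hj', div_eq_zero_iff]
    left
    rw [sub_eq_zero, Complex.exp_eq_exp_iff_exists_int]
    exact ⟨j, by push_cast; ring⟩

lemma norm_exp_I_mul (k : ℝ) : ‖cexp (I * k)‖ = 1 := by
  rw [mul_comm]; exact norm_exp_ofReal_mul_I k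

lemma integral_exp_div_one_sub {ζ : ℂ} (hζ : ‖ζ‖ < 1) (j : ℤ) :
    ∫ k in (-π)..π, cexp (I * k * j) / (1 - ζ * cexp (I * k)) =
      if j ≤ 0 then 2 * π * ζ ^ j.natAbs else 0 := by
  let f : ℕ → C(ℝ, ℂ) := fun m => ⟨fun k => cexp (I * k * j) * (ζ * cexp (I * k)) ^ m, by fun_prop⟩
  have hn : ∀ k : ℝ, ‖cexp (I * k * j)‖ = 1 := fun k => by
    have := norm_exp_I_mul (k * j)
    push_cast at this
    rwa [mul_assoc]
  have hs : Summable fun m => ‖(f m).restrict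
      (⟨Set.uIcc (-π) π, isCompact_uIcc⟩ : TopologicalSpace.Compacts ℝ)‖ := by
    refine Summable.of_nonneg_of_le (fun _ => norm_nonneg _) (fun m => ?_)
      (summable_geometric_of_lt_one (norm_nonneg ζ) hζ)
    rw [ContinuousMap.norm_le _ (by positivity)]
    intro k
    simp [f, hn]
  have h := intervalIntegral.hasSum_intervalIntegral_of_summable_norm hs
  have h1 : ∀ k : ℝ, ∑' m, f m k = cexp (I * k * j) / (1 - ζ * cexp (I * k)) := fun k => by
    simp only [f, ContinuousMap.coe_mk]
    rw [tsum_mul_left, tsum_geometric_of_norm_lt_one (by simpa [norm_exp_I_mul] using hζ),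
      div_eq_mul_inv]
  have h2 : ∀ m : ℕ, ∫ k in (-π)..π, f m k = if j + m = 0 then 2 * π * ζ ^ m else 0 := fun m => by
    have : ∀ k : ℝ, f m k = ζ ^ m * cexp (I * k * ((j + m : ℤ) : ℂ)) := fun k => by
      simp only [f, ContinuousMap.coe_mk]
      rw [mul_pow, ← Complex.exp_nat_mul, mul_left_comm, ← Complex.exp_add]
      push_cast
      ring_nf
    simp_rw [this]
    rw [intervalIntegral.integral_const_mul, integral_exp_int_mul_I]
    split_ifs <;> ring
  simp_rw [h1, h2] at h
  refine h.unique ?_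
  split_ifs with hj
  · have := hasSum_single (f := fun m : ℕ => if j + m = 0 then 2 * (π : ℂ) * ζ ^ m else 0)
      j.natAbs fun m hm => if_neg (by omega)
    rwa [if_pos (by omega)] at this
  · convert hasSum_zero using 2 with m
    exact if_neg (by omega)

lemma integral_exp_div_sub_cos {ζ : ℂ} (h0 : ζ ≠ 0) (hζ : ‖ζ‖ < 1) (n : ℤ) :
    ∫ k in (-π)..π, cexp (-I * k * n) / ((ζ + ζ⁻¹) / 2 - Real.cos k) =
      2 * π * ζ ^ n.natAbs * (2 / (ζ⁻¹ - ζ)) := by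
  have hne : ∀ k : ℝ, 1 - ζ * cexp (I * k) ≠ 0 := fun k h => by
    have : ‖ζ * cexp (I * k)‖ = 1 := by rw [← sub_eq_zero.mp h, norm_one]
    rw [norm_mul, norm_exp_I_mul, mul_one] at this
    exact hζ.ne this
  have hζ2 : 1 - ζ ^ 2 ≠ 0 := fun h => by
    have : ‖ζ ^ 2‖ = 1 := by rw [← sub_eq_zero.mp h, norm_one]
    rw [norm_pow] at this
    nlinarith [norm_nonneg ζ]
  have hdec : ∀ k : ℝ, cexp (-I * k * n) / ((ζ + ζ⁻¹) / 2 - Real.cos k) =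
      2 / (ζ⁻¹ - ζ) * (cexp (I * k * (-n : ℤ)) / (1 - ζ * cexp (I * k)) +
        ζ * (cexp (I * (-k : ℝ) * (n + 1 : ℤ)) / (1 - ζ * cexp (I * (-k : ℝ))))) := fun k => by
    have hk := hne k
    have hk' := hne (-k)
    have e1 : cexp (I * k * (-n : ℤ)) = cexp (-I * k * n) := by push_cast; ring_nf
    have e2 : cexp (I * (-k : ℝ) * (n + 1 : ℤ)) = cexp (-I * k * n) * cexp (I * (-k : ℝ)) := by
      rw [← Complex.exp_add]; push_cast; ring_nf
    have e3 : ((Real.cos k : ℝ) : ℂ) = (cexp (I * k) + cexp (I * (-k : ℝ))) / 2 := by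
      rw [Complex.ofReal_cos, Complex.cos]; push_cast; ring_nf
    have e4 : cexp (I * k) * cexp (I * (-k : ℝ)) = 1 := by
      rw [← Complex.exp_add]; push_cast; simp
    rw [e1, e2, e3]
    generalize cexp (-I * k * n) = A at *
    generalize cexp (I * (-k : ℝ)) = v at *
    generalize cexp (I * k) = u at *
    have hd : (ζ + ζ⁻¹) / 2 - (u + v) / 2 = (1 - ζ * u) * (1 - ζ * v) / (2 * ζ) := by
      field_simp
      linear_combination (-ζ ^ 2) * e4
    have hd' : ζ⁻¹ - ζ = (1 - ζ ^ 2) / ζ := by field_simp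
    rw [hd, hd']
    field_simp
    linear_combination (A * ζ ^ 2) * e4
  simp_rw [hdec]
  have c1 : Continuous fun k : ℝ => cexp (I * k * (-n : ℤ)) / (1 - ζ * cexp (I * k)) :=
    Continuous.div (by fun_prop) (by fun_prop) hne
  have c2 : Continuous fun k : ℝ => ζ * (cexp (I * (-k : ℝ) * (n + 1 : ℤ)) /
      (1 - ζ * cexp (I * (-k : ℝ)))) :=
    continuous_const.mul (Continuous.div (by fun_prop) (by fun_prop) fun k => hne (-k))
  rw [intervalIntegral.integral_const_mul, intervalIntegral.integral_add
    (c1.intervalIntegrable _ _) (c2.intervalIntegrable _ _), intervalIntegral.integral_const_mul,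
    integral_exp_div_one_sub hζ,
    intervalIntegral.integral_comp_neg
      (fun k : ℝ => cexp (I * k * (n + 1 : ℤ)) / (1 - ζ * cexp (I * k))),
    neg_neg, integral_exp_div_one_sub hζ]
  rcases lt_or_ge n 0 with hn | hn
  · rw [if_neg (by omega), if_pos (by omega), show n.natAbs = (n + 1).natAbs + 1 by omega]
    ring
  · rw [if_pos (by omega), if_neg (by omega), Int.natAbs_neg]
    ring

lemma quadrantSqrt_sub_sq_mul_add_sq {a : ℂ} (ha : 0 ≤ a.im) :
    (quadrantSqrt (a + 1) - quadrantSqrt (a - 1)) ^ 2 / 2 *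
      ((quadrantSqrt (a + 1) + quadrantSqrt (a - 1)) ^ 2 / 2) = 1 := by
  have sm := quadrantSqrt_sq (w := a - 1) (by simpa)
  have sp := quadrantSqrt_sq (w := a + 1) (by simpa)
  have : quadrantSqrt (a + 1) ^ 2 - quadrantSqrt (a - 1) ^ 2 = 2 := by rw [sm, sp]; ring
  linear_combination
    (quadrantSqrt (a + 1) ^ 2 - quadrantSqrt (a - 1) ^ 2 + 2) / 4 * this

lemma norm_quadrantSqrt_sub_sq_div_two_lt_one {a : ℂ} (ha : 0 < a.im) :
    ‖(quadrantSqrt (a + 1) - quadrantSqrt (a - 1)) ^ 2 / 2‖ < 1 := by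
  have hm : 0 < (a - 1).im := by simpa
  have hp : 0 < (a + 1).im := by simpa
  have hlt := norm_sub_lt_norm_add_of_quadrant (quadrantSqrt_re_pos hm) (quadrantSqrt_im_pos hm)
    (quadrantSqrt_re_pos hp) (quadrantSqrt_im_pos hp)
  have h1 := congrArg norm (quadrantSqrt_sub_sq_mul_add_sq ha.le)
  rw [norm_mul, norm_one] at h1
  generalize quadrantSqrt (a - 1) = p at *
  generalize quadrantSqrt (a + 1) = q at *
  have h2 : ‖(q - p) ^ 2 / 2‖ < ‖(q + p) ^ 2 / 2‖ := by
    simp only [norm_div, norm_pow]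
    gcongr
    simp
  nlinarith [norm_nonneg ((q - p) ^ 2 / 2)]

/-- The value of `∫ e^{-ikn} / (a - cos k) dk` for `a` in the upper half plane. -/
noncomputable def cosResolvent (n : ℤ) (a : ℂ) : ℂ :=
  2 * π * ((quadrantSqrt (a + 1) - quadrantSqrt (a - 1)) ^ 2 / 2) ^ n.natAbs /
    (quadrantSqrt (a - 1) * quadrantSqrt (a + 1))

lemma integral_exp_div_sub_cos_eq_cosResolvent (n : ℤ) {a : ℂ} (ha : 0 < a.im) :
    ∫ k in (-π)..π, cexp (-I * k * n) / (a - Real.cos k) = cosResolvent n a := by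
  have hm : 0 < (a - 1).im := by simpa
  have hp : 0 < (a + 1).im := by simpa
  have sm := quadrantSqrt_sq hm.le
  have sp := quadrantSqrt_sq hp.le
  have nm : quadrantSqrt (a - 1) ≠ 0 := fun h => by
    have := quadrantSqrt_re_pos hm
    simp [h] at this
  have np : quadrantSqrt (a + 1) ≠ 0 := fun h => by
    have := quadrantSqrt_re_pos hp
    simp [h] at this
  have hmul := quadrantSqrt_sub_sq_mul_add_sq ha.le
  have hnorm := norm_quadrantSqrt_sub_sq_div_two_lt_one ha
  unfold cosResolvent
  generalize quadrantSqrt (a - 1) = p at *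
  generalize quadrantSqrt (a + 1) = q at *
  have h0 : (q - p) ^ 2 / 2 ≠ 0 := left_ne_zero_of_mul_eq_one hmul
  have hinv : ((q - p) ^ 2 / 2)⁻¹ = (q + p) ^ 2 / 2 := inv_eq_of_mul_eq_one_right hmul
  have hsum : ((q - p) ^ 2 / 2 + ((q - p) ^ 2 / 2)⁻¹) / 2 = a := by
    rw [hinv]; linear_combination (sm + sp) / 2
  have := integral_exp_div_sub_cos h0 hnorm n
  rw [hsum, hinv] at this
  rw [this, show (q + p) ^ 2 / 2 - (q - p) ^ 2 / 2 = 2 * (p * q) by ring]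
  field_simp

lemma norm_cosResolvent_le (n : ℤ) {a : ℂ} (ha : 0 < a.im) (h1 : a.re ≠ 1) (h2 : a.re ≠ -1) :
    ‖cosResolvent n a‖ ≤ 2 * π * ((√|a.re - 1|)⁻¹ * (√|a.re + 1|)⁻¹) := by
  have hm : 0 < (a - 1).im := by simpa
  have hp : 0 < (a + 1).im := by simpa
  have hp1 : 0 < |a.re - 1| := abs_pos.mpr (sub_ne_zero.mpr h1)
  have hp2 : 0 < |a.re + 1| := abs_pos.mpr fun h => h2 (eq_neg_of_add_eq_zero_left h)
  have hre1 : |a.re - 1| ≤ ‖a - 1‖ := by simpa using Complex.abs_re_le_norm (a - 1)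
  have hre2 : |a.re + 1| ≤ ‖a + 1‖ := by simpa using Complex.abs_re_le_norm (a + 1)
  have hz := pow_le_one₀ (n := n.natAbs) (norm_nonneg _)
    (norm_quadrantSqrt_sub_sq_div_two_lt_one ha).le
  rw [cosResolvent, norm_div, norm_mul, norm_mul _ (quadrantSqrt (a + 1)), norm_quadrantSqrt hm.le,
    norm_quadrantSqrt hp.le, norm_pow, div_eq_mul_inv, mul_inv,
    show ‖2 * (π : ℂ)‖ = 2 * π by simp [abs_of_pos pi_pos]]
  refine mul_le_mul (mul_le_of_le_one_right (by positivity) hz) ?_ (by positivity) (by positivity)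
  gcongr



lemma continuousAt_cosResolvent (n : ℤ) {a : ℂ} (ha : 0 ≤ a.im) (h1 : a ≠ 1) (h2 : a ≠ -1) :
    ContinuousAt (cosResolvent n) a := by
  have hm : quadrantSqrt (a - 1) ≠ 0 := fun h => by
    have := quadrantSqrt_sq (w := a - 1) (by simpa)
    rw [h] at this
    exact h1 (sub_eq_zero.mp (by simpa using this.symm))
  have hp : quadrantSqrt (a + 1) ≠ 0 := fun h => by
    have := quadrantSqrt_sq (w := a + 1) (by simpa)
    rw [h] at this
    exact h2 (eq_neg_of_add_eq_zero_left (by simpa using this.symm))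
  have := continuous_quadrantSqrt
  unfold cosResolvent
  exact ContinuousAt.div (by fun_prop) (by fun_prop) (mul_ne_zero hm hp)

lemma intervalIntegrable_inv_sqrt_abs_sin_half :
    IntervalIntegrable (fun k => (√|Real.sin (k / 2)|)⁻¹) volume (-π) π := by
  have h0 : IntervalIntegrable (fun k : ℝ => k ^ (-(1 / 2) : ℝ)) volume 0 π :=
    intervalIntegral.intervalIntegrable_rpow' (by norm_num)
  have h1 : IntervalIntegrable (fun k : ℝ => (√|Real.sin (k / 2)|)⁻¹) volume 0 π := by
    refine (h0.const_mul (√(π⁻¹))⁻¹).mono_fun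
      (Measurable.aestronglyMeasurable (by fun_prop)) ?_
    rw [Set.uIoc_of_le pi_pos.le]
    refine (ae_restrict_iff' measurableSet_Ioc).mpr (.of_forall fun k hk => ?_)
    have hk' : π⁻¹ * k ≤ |Real.sin (k / 2)| := by
      refine le_trans (le_of_eq ?_) (Real.mul_abs_le_abs_sin (x := k / 2) ?_)
      · rw [abs_of_pos (by linarith [hk.1])]; field_simp
      · rw [abs_of_pos (by linarith [hk.1])]; linarith [hk.2]
    beta_reduce
    rw [Real.rpow_neg hk.1.le, ← Real.sqrt_eq_rpow, ← mul_inv, ← Real.sqrt_mul (by positivity),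
      Real.norm_of_nonneg (by positivity), Real.norm_of_nonneg (by positivity)]
    have : 0 < π⁻¹ * k := mul_pos (by positivity) hk.1
    gcongr
  have h2 : IntervalIntegrable (fun k : ℝ => (√|Real.sin (k / 2)|)⁻¹) volume (-π) 0 := by
    rw [IntervalIntegrable.iff_comp_neg, neg_neg, neg_zero]
    simpa [neg_div] using h1.symm
  exact h2.trans h1

lemma intervalIntegrable_inv_sqrt_abs_sin_half_add (θ : ℝ) :
    IntervalIntegrable (fun k => (√|Real.sin ((k + θ) / 2)|)⁻¹) volume (-π) π := by
  have hper : Function.Periodic (fun k => (√|Real.sin (k / 2)|)⁻¹) (2 * π) := fun k => by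
    have : (k + 2 * π) / 2 = k / 2 + π := by ring
    simp only [this, Real.sin_add_pi, abs_neg]
  have h := hper.intervalIntegrable (t := -π) (by positivity)
    (by convert intervalIntegrable_inv_sqrt_abs_sin_half using 1; ring) (-π + θ) (π + θ)
  simpa using h.comp_add_right θ

lemma inv_sqrt_abs_cos_sub_cos_le {θ : ℝ} (hθ : θ ∈ Set.Ioo 0 π) (k : ℝ) :
    (√|Real.cos θ - Real.cos k|)⁻¹ ≤ (Real.sin θ)⁻¹ *
      ((√|Real.sin ((k + θ) / 2)|)⁻¹ + (√|Real.sin ((k + -θ) / 2)|)⁻¹) := by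
  have hs := Real.sin_pos_of_mem_Ioo hθ
  have hc : |Real.cos θ - Real.cos k| =
      2 * (|Real.sin ((k + θ) / 2)| * |Real.sin ((k + -θ) / 2)|) := by
    rw [abs_sub_comm, Real.cos_sub_cos, abs_mul, abs_mul, ← sub_eq_add_neg]
    norm_num [mul_assoc]
  have hadd : Real.sin θ ≤ |Real.sin ((k + θ) / 2)| + |Real.sin ((k + -θ) / 2)| := by
    have e : Real.sin θ = Real.sin ((k + θ) / 2 - (k + -θ) / 2) := by ring_nf
    rw [e, Real.sin_sub]
    refine (le_abs_self _).trans ((abs_sub _ _).trans ?_)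
    rw [abs_mul, abs_mul]
    exact add_le_add (mul_le_of_le_one_right (abs_nonneg _) (Real.abs_cos_le_one _))
      (mul_le_of_le_one_left (abs_nonneg _) (Real.abs_cos_le_one _))
  have hu0 := abs_nonneg (Real.sin ((k + θ) / 2))
  have hv0 := abs_nonneg (Real.sin ((k + -θ) / 2))
  have hu1 := Real.abs_sin_le_one ((k + θ) / 2)
  have hv1 := Real.abs_sin_le_one ((k + -θ) / 2)
  rw [hc]
  generalize |Real.sin ((k + θ) / 2)| = u at *
  generalize |Real.sin ((k + -θ) / 2)| = v at *
  generalize Real.sin θ = s at *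
  rcases hu0.eq_or_lt with rfl | hu
  · simp only [zero_mul, mul_zero, Real.sqrt_zero, inv_zero]
    positivity
  rcases hv0.eq_or_lt with rfl | hv
  · simp only [mul_zero, Real.sqrt_zero, inv_zero]
    positivity
  have hx : 0 < √u := Real.sqrt_pos.mpr hu
  have hy : 0 < √v := Real.sqrt_pos.mpr hv
  have hle : s ≤ √u + √v := hadd.trans
    (add_le_add (Real.le_sqrt_of_sq_le (by nlinarith)) (Real.le_sqrt_of_sq_le (by nlinarith)))
  calc (√(2 * (u * v)))⁻¹ ≤ (√(u * v))⁻¹ := by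
        have : 0 < u * v := mul_pos hu hv
        exact inv_anti₀ (Real.sqrt_pos.mpr this) (Real.sqrt_le_sqrt (by linarith))
    _ = s⁻¹ * (s * (√u * √v)⁻¹) := by rw [Real.sqrt_mul hu.le]; field_simp
    _ ≤ s⁻¹ * ((√u + √v) * (√u * √v)⁻¹) := by gcongr
    _ = s⁻¹ * ((√u)⁻¹ + (√v)⁻¹) := by field_simp; ring

lemma intervalIntegrable_inv_sqrt_abs_sub_cos {c : ℝ} (hc : c ∈ Set.Ioo (-1 : ℝ) 1) :
    IntervalIntegrable (fun k => (√|c - Real.cos k|)⁻¹) volume (-π) π := by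
  have hθ : Real.arccos c ∈ Set.Ioo 0 π :=
    ⟨Real.arccos_pos.mpr hc.2, Real.arccos_lt_pi.mpr hc.1⟩
  refine (((intervalIntegrable_inv_sqrt_abs_sin_half_add (Real.arccos c)).add
    (intervalIntegrable_inv_sqrt_abs_sin_half_add (-Real.arccos c))).const_mul
      (Real.sin (Real.arccos c))⁻¹).mono_fun (Measurable.aestronglyMeasurable (by fun_prop)) ?_
  refine .of_forall fun k => ?_
  have := inv_sqrt_abs_cos_sub_cos_le hθ k
  rw [Real.cos_arccos hc.1.le hc.2.le] at this
  beta_reduce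
  rw [Real.norm_of_nonneg (by positivity)]
  exact this.trans (le_abs_self _)

lemma intervalIntegrable_inv_sqrt_mul_inv_sqrt {e : ℝ} (he : e ∈ Set.Ioo (0 : ℝ) 4) (he2 : e ≠ 2) :
    IntervalIntegrable (fun k => (√|2 - Real.cos k - e - 1|)⁻¹ * (√|2 - Real.cos k - e + 1|)⁻¹)
      volume (-π) π := by
  obtain ⟨he0, he4⟩ := he
  rcases lt_or_gt_of_ne he2 with h | h
  · refine ((intervalIntegrable_inv_sqrt_abs_sub_cos (c := 1 - e)
      ⟨by linarith, by linarith⟩).mul_const (√(2 - e))⁻¹).mono_fun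
      (Measurable.aestronglyMeasurable (by fun_prop)) (.of_forall fun k => ?_)
    have h1 : 0 < 2 - e := by linarith
    have h2 : 2 - e ≤ |2 - Real.cos k - e + 1| :=
      le_trans (by linarith [Real.cos_le_one k]) (le_abs_self _)
    beta_reduce
    rw [Real.norm_of_nonneg (by positivity), Real.norm_of_nonneg (by positivity),
      show 2 - Real.cos k - e - 1 = 1 - e - Real.cos k by ring]
    gcongr
  · refine ((intervalIntegrable_inv_sqrt_abs_sub_cos (c := 3 - e)
      ⟨by linarith, by linarith⟩).const_mul (√(e - 2))⁻¹).mono_fun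
      (Measurable.aestronglyMeasurable (by fun_prop)) (.of_forall fun k => ?_)
    have h1 : 0 < e - 2 := by linarith
    have h2 : e - 2 ≤ |2 - Real.cos k - e - 1| :=
      le_trans (by linarith [Real.neg_one_le_cos k]) (neg_le_abs _)
    beta_reduce
    rw [Real.norm_of_nonneg (by positivity), Real.norm_of_nonneg (by positivity),
      show 2 - Real.cos k - e + 1 = 3 - e - Real.cos k by ring]
    gcongr

lemma ae_cos_ne (c : ℝ) : ∀ᵐ k : ℝ, Real.cos k ≠ c := by
  have hc : {k : ℝ | Real.cos k = c}.Countable := by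
    rcases {k : ℝ | Real.cos k = c}.eq_empty_or_nonempty with h | ⟨k₀, hk₀⟩
    · simp [h]
    · refine ((Set.countable_range fun n : ℤ => 2 * n * π + k₀).union
        (Set.countable_range fun n : ℤ => 2 * n * π - k₀)).mono fun k hk => ?_
      obtain ⟨n, h | h⟩ := Real.cos_eq_cos_iff.mp (hk₀.trans (Eq.symm hk))
      · exact .inl ⟨n, h.symm⟩
      · exact .inr ⟨n, h.symm⟩
  rw [ae_iff]
  simpa using hc.measure_zero volume

lemma latticeGreen_eq_integral_cosResolvent {z : ℂ} (hz : z.im < 0) (x₁ x₂ : ℤ) :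
    latticeGreen z x₁ x₂ = ((2 * Real.pi) ^ 2)⁻¹ •
      ∫ k in (-π)..π, cexp (-I * k * x₁) * cosResolvent x₂ (2 - Real.cos k - z) := by
  have hne : ∀ k : ℝ × ℝ, ((2 - Real.cos k.1 - Real.cos k.2 : ℝ) : ℂ) - z ≠ 0 := fun k h => by
    have := congrArg Complex.im h
    rw [Complex.sub_im, Complex.ofReal_im, Complex.zero_im] at this
    linarith
  have hcont : Continuous fun k : ℝ × ℝ =>
      cexp (-I * ((k.1 : ℂ) * (x₁ : ℂ) + (k.2 : ℂ) * (x₂ : ℂ))) /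
        (((2 - Real.cos k.1 - Real.cos k.2 : ℝ) : ℂ) - z) :=
    Continuous.div (by fun_prop) (by fun_prop) hne
  have hint := hcont.continuousOn.integrableOn_compact (μ := volume)
    (isCompact_Icc (a := ((-π, -π) : ℝ × ℝ)) (b := (π, π)))
  have hπ : -π ≤ π := by linarith [pi_pos]
  rw [latticeGreen]
  rw [← Set.Icc_prod_Icc, Measure.volume_eq_prod] at hint ⊢
  rw [setIntegral_prod _ hint, intervalIntegral.integral_of_le hπ, integral_Icc_eq_integral_Ioc]
  congr 1
  refine integral_congr_ae (.of_forall fun k => ?_)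
  have ha : 0 < (2 - Real.cos k - z : ℂ).im := by
    simp only [Complex.sub_im, Complex.ofReal_im, Complex.im_ofNat]; linarith
  beta_reduce
  rw [← integral_exp_div_sub_cos_eq_cosResolvent x₂ ha, ← intervalIntegral.integral_const_mul,
    intervalIntegral.integral_of_le hπ, integral_Icc_eq_integral_Ioc]
  refine integral_congr_ae (.of_forall fun l => ?_)
  beta_reduce
  rw [← mul_div_assoc, ← Complex.exp_add]
  push_cast
  ring_nf

lemma latticeGreen_conj (z : ℂ) (x₁ x₂ : ℤ) :
    latticeGreen (starRingEnd ℂ z) x₁ x₂ = starRingEnd ℂ (latticeGreen z (-x₁) (-x₂)) := by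
  rw [latticeGreen, latticeGreen, Complex.real_smul, Complex.real_smul, map_mul,
    Complex.conj_ofReal, ← integral_conj]
  congr 2
  funext k
  rw [map_div₀, ← Complex.exp_conj, map_sub, Complex.conj_ofReal]
  simp
  ring_nf

open Filter Topology in
lemma exists_tendsto_latticeGreen_sub (x₁ x₂ : ℤ) {e : ℝ} (he : e ∈ Set.Ioo (0 : ℝ) 4)
    (he2 : e ≠ 2) :
    ∃ L : ℂ, Tendsto (fun ε : ℝ => latticeGreen ((e : ℂ) - ε * Complex.I) x₁ x₂)
      (𝓝[>] 0) (𝓝 L) := by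
  refine ⟨((2 * Real.pi) ^ 2)⁻¹ • ∫ k in (-π)..π,
    cexp (-I * k * x₁) * cosResolvent x₂ (2 - Real.cos k - e), ?_⟩
  have heq : (fun ε : ℝ => ((2 * Real.pi) ^ 2)⁻¹ • ∫ k in (-π)..π,
      cexp (-I * k * x₁) * cosResolvent x₂ (2 - Real.cos k - (e - ε * I))) =ᶠ[𝓝[>] 0]
      fun ε : ℝ => latticeGreen ((e : ℂ) - ε * Complex.I) x₁ x₂ := by
    filter_upwards [self_mem_nhdsWithin] with ε hε
    exact (latticeGreen_eq_integral_cosResolvent (by simpa using hε) x₁ x₂).symm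
  refine Tendsto.congr' heq (Tendsto.const_smul ?_ _)
  have hm := continuous_quadrantSqrt.measurable
  have him : ∀ k ε : ℝ, (2 - Real.cos k - (e - ε * I) : ℂ).im = ε := fun k ε => by
    simp [-Complex.ofReal_cos]
  have hre : ∀ k ε : ℝ, (2 - Real.cos k - (e - ε * I) : ℂ).re = 2 - Real.cos k - e := fun k ε => by
    simp [-Complex.ofReal_cos]
  refine intervalIntegral.tendsto_integral_filter_of_dominated_convergence
    (fun k => 2 * π * ((√|2 - Real.cos k - e - 1|)⁻¹ * (√|2 - Real.cos k - e + 1|)⁻¹))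
    (.of_forall fun ε => Measurable.aestronglyMeasurable (by unfold cosResolvent; fun_prop)) ?_
    ((intervalIntegrable_inv_sqrt_mul_inv_sqrt he he2).const_mul _) ?_
  · filter_upwards [self_mem_nhdsWithin] with ε hε
    filter_upwards [ae_cos_ne (1 - e), ae_cos_ne (3 - e)] with k h1 h3 _
    have hexp : ‖cexp (-I * k * x₁)‖ = 1 := by
      have := norm_exp_I_mul (-(k * x₁))
      push_cast at this
      rwa [mul_neg, ← neg_mul, ← mul_assoc] at this
    rw [norm_mul, hexp, one_mul, ← hre k ε]
    refine norm_cosResolvent_le x₂ (by rw [him]; exact hε) ?_ ?_ <;> rw [hre] <;> intro h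
    · exact h1 (by linarith)
    · exact h3 (by linarith)
  · filter_upwards [ae_cos_ne (1 - e), ae_cos_ne (3 - e)] with k h1 h3 _
    have hc : ContinuousAt (cosResolvent x₂) (2 - Real.cos k - e) := by
      refine continuousAt_cosResolvent x₂ (by simp [-Complex.ofReal_cos]) ?_ ?_ <;> intro h
      · exact h1 (by have : 2 - Real.cos k - e = 1 := by exact_mod_cast h
                     linarith)
      · exact h3 (by have : 2 - Real.cos k - e = -1 := by exact_mod_cast h
                     linarith)
    refine Tendsto.const_mul _ (hc.tendsto.comp ?_)
    refine Tendsto.mono_left ?_ nhdsWithin_le_nhds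
    have : Continuous fun ε : ℝ => (2 - Real.cos k - (e - ε * I) : ℂ) := by fun_prop
    simpa using this.tendsto 0

open Filter Topology in
/-- The boundary values `g₊(e;x) = lim_{ε→0⁺} g(e+iε;x)` and
`g₋(e;x) = lim_{ε→0⁺} g(e-iε;x)` exist for all `e ∈ (0,4)`, `e ≠ 2`. -/
theorem latticeGreen_boundary_values_exist (x₁ x₂ : ℤ)
    (e : ℝ) (he : e ∈ Set.Ioo (0 : ℝ) 4) (he2 : e ≠ 2) :
    (∃ L : ℂ, Tendsto (fun ε : ℝ => latticeGreen ((e : ℂ) + ε * Complex.I) x₁ x₂)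
        (𝓝[>] 0) (𝓝 L)) ∧
    (∃ L' : ℂ, Tendsto (fun ε : ℝ => latticeGreen ((e : ℂ) - ε * Complex.I) x₁ x₂)
        (𝓝[>] 0) (𝓝 L')) := by
  refine ⟨?_, exists_tendsto_latticeGreen_sub x₁ x₂ he he2⟩
  obtain ⟨L, hL⟩ := exists_tendsto_latticeGreen_sub (-x₁) (-x₂) he he2
  refine ⟨starRingEnd ℂ L, ((Complex.continuous_conj.tendsto L).comp hL).congr fun ε => ?_⟩
  rw [Function.comp_apply, ← latticeGreen_conj]
  simp
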